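/- Let n ≥ 4. The outer automorphism group Out(F_n) of the free group F_n on n generators is not abstractly commensurable with the right-angled Artin group A(Γ) of any finite simple graph Γ. -/

import Mathlib

/-- The defining relators of the right-angled Artin group on the simple graph `Γ`:
one commutator relator for each edge of `Γ`. -/
def raagRels {V : Type*} (Γ : SimpleGraph V) : Set (FreeGroup V) :=
  {r : FreeGroup V | ∃ u w : V, Γ.Adj u w ∧
    r = FreeGroup.of u * FreeGroup.of w * (FreeGroup.of u)⁻¹ * (FreeGroup.of w)⁻¹}

/-- The right-angled Artin group of a simple graph `Γ`: the presented group with one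
generator for each vertex of `Γ` and a commutator relator for each edge of `Γ`. -/
abbrev RAAG {V : Type*} (Γ : SimpleGraph V) : Type _ :=
  PresentedGroup (raagRels Γ)

/-- Two groups are abstractly commensurable if they have isomorphic finite-index
subgroups. -/
def AbstractlyCommensurable (G H : Type*) [Group G] [Group H] : Prop :=
  ∃ (G' : Subgroup G) (H' : Subgroup H),
    G'.FiniteIndex ∧ H'.FiniteIndex ∧ Nonempty (G' ≃* H')

/-- The subgroup of inner automorphisms of `G`: the range of the conjugation
homomorphism `G →* Aut G`. -/
def innerAutSubgroup (G : Type*) [Group G] : Subgroup (MulAut G) :=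
  (MulAut.conj : G →* MulAut G).range

instance (G : Type*) [Group G] : (innerAutSubgroup G).Normal := by
  constructor
  rintro a ⟨g, rfl⟩ σ
  refine ⟨σ g, ?_⟩
  ext x
  simp [MulAut.conj_apply, MulAut.mul_apply, map_mul, map_inv]

/-- The outer automorphism group of `G`: the quotient of the automorphism group of `G`
by the normal subgroup of inner automorphisms. -/
def Out (G : Type*) [Group G] : Type _ :=
  MulAut G ⧸ innerAutSubgroup G

instance (G : Type*) [Group G] : Group (Out G) :=
  QuotientGroup.Quotient.group _

/-- Every nontrivial element `z` of `G` is detected by an integer-valued character of every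
subgroup of `G` in which `z` is central. -/
def HasCentralCharacters (G : Type*) [Group G] : Prop :=
  ∀ (K : Subgroup G) (z : K), z ≠ 1 → (∀ k : K, k * z = z * k) →
    ∃ f : K →* Multiplicative ℤ, f z ≠ 1

namespace HasCentralCharacters

theorem exists_character {G K : Type*} [Group G] [Group K] (hG : HasCentralCharacters G)
    (φ : K →* G) (c : K) (hc : φ c ≠ 1) (hcomm : ∀ k, φ k * φ c = φ c * φ k) :
    ∃ f : K →* Multiplicative ℤ, f c ≠ 1 := by
  obtain ⟨f, hf⟩ := hG φ.range (φ.rangeRestrict c)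
    (fun h => hc (congrArg Subtype.val h))
    (by rintro ⟨_, k, rfl⟩; exact Subtype.ext (hcomm k))
  exact ⟨f.comp φ.rangeRestrict, hf⟩

theorem of_injective {G H : Type*} [Group G] [Group H] (hG : HasCentralCharacters G)
    (φ : H →* G) (hφ : Function.Injective φ) : HasCentralCharacters H := by
  intro K z hz hcomm
  refine hG.exists_character (φ.comp K.subtype) z ?_ fun k => ?_
  · simpa [map_eq_one_iff φ hφ] using hz
  · rw [← map_mul, ← map_mul, hcomm]

end HasCentralCharacters

theorem multiplicative_int_eq_one_of_pow_eq_one {x : Multiplicative ℤ} {n : ℕ} (hn : n ≠ 0)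
    (h : x ^ n = 1) : x = 1 := by
  have h' := congrArg Multiplicative.toAdd h
  rw [toAdd_pow, toAdd_one, nsmul_eq_mul] at h'
  rcases mul_eq_zero.1 h' with h0 | h0
  · exact absurd (by exact_mod_cast h0) hn
  · exact Multiplicative.toAdd.injective h0

/-- A character of a finite-index subgroup which detects a power of a central element induces,
by transfer, a character of the whole group which detects that element. -/
theorem exists_character_of_finiteIndex {K : Type*} [Group K] (H : Subgroup K) [H.FiniteIndex]
    (f : H →* Multiplicative ℤ) (c : K) (hc : ∀ k, k * c = c * k) (m : ℕ) (hm : c ^ m ∈ H)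
    (hf : f ⟨c ^ m, hm⟩ ≠ 1) : ∃ g : K →* Multiplicative ℤ, g c ≠ 1 := by
  have key : ∀ (k : ℕ) (g₀ : K), g₀⁻¹ * c ^ k * g₀ ∈ H → g₀⁻¹ * c ^ k * g₀ = c ^ k := by
    intro k g₀ _
    have : Commute g₀ (c ^ k) := (show Commute g₀ c from hc g₀).pow_right k
    rw [mul_assoc, ← this.eq, inv_mul_cancel_left]
  refine ⟨f.transfer, fun h => hf ?_⟩
  rw [MonoidHom.transfer_eq_pow f c key] at h
  refine multiplicative_int_eq_one_of_pow_eq_one (n := H.index) Subgroup.FiniteIndex.index_ne_zero ?_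
  have h2 : (⟨c ^ m, hm⟩ : H) ^ H.index
      = ⟨c ^ H.index, MonoidHom.transfer_eq_pow_aux c key⟩ ^ m := by
    apply Subtype.ext
    simp only [SubmonoidClass.mk_pow]
    rw [← pow_mul, ← pow_mul, mul_comm]
  rw [← map_pow, h2, map_pow, h, one_pow]

namespace FreeGroup

theorem eq_one_of_commute_of {X : Type*} {x y : X} (hxy : x ≠ y) {w : FreeGroup X}
    (hw : ∀ g, g * w = w * g) : w = 1 := by
  classical
  by_contra hne
  obtain ⟨L, p, hL⟩ : ∃ L p, w.toWord = L ++ [p] := by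
    rcases List.eq_nil_or_concat w.toWord with h | ⟨L, p, h⟩
    · exact absurd (toWord_eq_nil_iff.1 h) hne
    · exact ⟨L, p, by simpa using h⟩
  obtain ⟨q, hq⟩ : ∃ q : X, q ≠ p.1 := by
    by_cases h : x = p.1
    · exact ⟨y, fun h' => hxy (h.trans h'.symm)⟩
    · exact ⟨x, h⟩
  have hred : IsReduced (w.toWord ++ [(q, true)] ++ w⁻¹.toWord) := by
    have h1 : IsReduced w.toWord := isReduced_toWord
    have h2 : IsReduced w⁻¹.toWord := isReduced_toWord
    rw [toWord_inv] at h2 ⊢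
    rw [hL] at h1 h2 ⊢
    have e : invRev (L ++ [p]) = (p.1, !p.2) :: invRev L := by simp [invRev]
    rw [e] at h2 ⊢
    unfold IsReduced at *
    rw [List.append_assoc, List.isChain_append]
    refine ⟨h1, ?_, ?_⟩
    · rw [List.singleton_append, List.isChain_cons_cons]
      exact ⟨fun h => absurd h hq, h2⟩
    · simpa using fun h => absurd h.symm hq
  have h3 : (w * of q * w⁻¹).toWord = w.toWord ++ [(q, true)] ++ w⁻¹.toWord := by
    rw [← hred.reduce_eq, ← toWord_mk]
    congr 1
    rw [← mul_mk, ← mul_mk, mk_toWord, mk_toWord]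
    rfl
  rw [← hw, mul_inv_cancel_right, toWord_of, hL] at h3
  have := congrArg List.length h3
  simp [toWord_inv, hL] at this
  omega

theorem hasCentralCharacters (X : Type*) : HasCentralCharacters (FreeGroup X) := by
  intro K z hz hcomm
  let e := IsFreeGroup.toFreeGroup K
  have hz' : e z ≠ 1 := by simpa using hz
  have hsub : ∀ x y : IsFreeGroup.Generators K, x = y := by
    intro x y
    by_contra hxy
    refine hz' (eq_one_of_commute_of hxy fun g => ?_)
    obtain ⟨k, rfl⟩ := e.surjective g
    rw [← _root_.map_mul, ← _root_.map_mul, hcomm]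
  have hne : Nonempty (IsFreeGroup.Generators K) := by
    by_contra h
    rw [not_nonempty_iff] at h
    exact hz' (Subsingleton.elim _ _)
  obtain ⟨x⟩ := hne
  let _ : Unique (IsFreeGroup.Generators K) := ⟨⟨x⟩, fun y => hsub y x⟩
  refine ⟨(e.trans mulEquivIntOfUnique).toMonoidHom, ?_⟩
  simpa using hz

/-- The endomorphism of the free group which kills the generators outside `T` and fixes those
in `T`. -/
noncomputable def retract {S : Type*} (T : Set S) : FreeGroup S →* FreeGroup S :=
  open Classical in lift fun s => if s ∈ T then of s else 1

theorem retract_of_mem {S : Type*} {T : Set S} {s : S} (h : s ∈ T) :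
    retract T (of s) = of s := by simp [retract, h]

theorem retract_of_notMem {S : Type*} {T : Set S} {s : S} (h : s ∉ T) :
    retract T (of s) = 1 := by simp [retract, h]

theorem retract_retract {S : Type*} (T U : Set S) (w : FreeGroup S) :
    retract T (retract U w) = retract (T ∩ U) w := by
  suffices h : (retract T).comp (retract U) = retract (T ∩ U) from DFunLike.congr_fun h w
  ext s
  by_cases hT : s ∈ T <;> by_cases hU : s ∈ U <;> simp [retract, hT, hU]

theorem retract_map {S : Type*} (T : Set S) (σ : S ≃ S) (w : FreeGroup S) :
    retract (σ '' T) (freeGroupCongr σ w) = freeGroupCongr σ (retract T w) := by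
  suffices h : (retract (σ '' T)).comp (freeGroupCongr σ).toMonoidHom
      = (freeGroupCongr σ).toMonoidHom.comp (retract T) from DFunLike.congr_fun h w
  ext s
  by_cases hT : s ∈ T <;> simp [retract, hT]

theorem exists_finset_retract_eq {S : Type*} (w : FreeGroup S) :
    ∃ T : Finset S, retract (T : Set S) w = w := by
  classical
  have mono : ∀ {T U : Finset S} {w : FreeGroup S}, T ⊆ U → retract (T : Set S) w = w →
      retract (U : Set S) w = w := by
    intro T U w h hw
    rw [← hw, retract_retract, Set.inter_eq_right.2 (by exact_mod_cast h)]
  induction w using FreeGroup.induction_on with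
  | C1 => exact ⟨∅, _root_.map_one _⟩
  | of s => exact ⟨{s}, retract_of_mem (by simp)⟩
  | inv_of s h =>
    obtain ⟨T, hT⟩ := h
    exact ⟨T, by rw [_root_.map_inv, hT]⟩
  | mul x y hx hy =>
    obtain ⟨T, hT⟩ := hx
    obtain ⟨U, hU⟩ := hy
    refine ⟨T ∪ U, ?_⟩
    rw [_root_.map_mul, mono Finset.subset_union_left hT, mono Finset.subset_union_right hU]

/-- Every element of a free group has a conjugate whose support is contained in the support of
every further conjugate. -/
theorem exists_conj_minimal_support {S : Type*} (w : FreeGroup S) :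
    ∃ (u : FreeGroup S) (T : Finset S), retract (T : Set S) (u * w * u⁻¹) = u * w * u⁻¹ ∧
      ∀ (U : Finset S) (v : FreeGroup S),
        retract (U : Set S) (v * w * v⁻¹) = v * w * v⁻¹ → T ⊆ U := by
  classical
  let P : ℕ → Prop := fun n => ∃ (T : Finset S) (u : FreeGroup S), T.card = n ∧
    retract (T : Set S) (u * w * u⁻¹) = u * w * u⁻¹
  have hP : ∃ n, P n := by
    obtain ⟨T, hT⟩ := exists_finset_retract_eq w
    exact ⟨T.card, T, 1, rfl, by simpa using hT⟩
  obtain ⟨T, u, hcard, hT⟩ := Nat.find_spec hP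
  refine ⟨u, T, hT, fun U v hU => ?_⟩
  -- the conjugate of `w` obtained by retracting `u * w * u⁻¹` to `U` is supported on `T ∩ U`
  have hconj : retract (U : Set S) (u * w * u⁻¹) =
      (retract (U : Set S) (u * v⁻¹) * v) * w * (retract (U : Set S) (u * v⁻¹) * v)⁻¹ := by
    have : u * w * u⁻¹ = (u * v⁻¹) * (v * w * v⁻¹) * (u * v⁻¹)⁻¹ := by group
    rw [this, _root_.map_mul, _root_.map_mul, hU, _root_.map_inv]
    group
  have hmin : T.card ≤ (T ∩ U).card := by
    rw [hcard]
    refine Nat.find_min' hP ⟨T ∩ U, retract (U : Set S) (u * v⁻¹) * v, rfl, ?_⟩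
    rw [← hconj]
    conv_rhs => rw [← hT, retract_retract, Set.inter_comm]
    rw [retract_retract, Finset.coe_inter, Set.inter_assoc, Set.inter_self]
  exact Finset.inter_eq_left.1 (Finset.eq_of_subset_of_card_le Finset.inter_subset_left hmin)

/-- The action on the free group on a `B`-set by permutation of the generators. -/
def permAut (B S : Type*) [Group B] [MulAction B S] : B →* MulAut (FreeGroup S) where
  toFun b := freeGroupCongr (MulAction.toPerm b)
  map_one' := by
    apply MulEquiv.toMonoidHom_injective
    ext s
    simp
  map_mul' b c := by
    apply MulEquiv.toMonoidHom_injective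
    ext s
    simp [mul_smul]

@[simp]
theorem permAut_of {B S : Type*} [Group B] [MulAction B S] (b : B) (s : S) :
    permAut B S b (of s) = of (b • s) := by
  simp [permAut]

theorem retract_permAut {B S : Type*} [Group B] [MulAction B S] {T : Set S} {b : B}
    (hb : ∀ s ∈ T, b • s = s) (w : FreeGroup S) :
    retract T (permAut B S b w) = retract T w := by
  suffices h : (retract T).comp (permAut B S b).toMonoidHom = retract T from
    DFunLike.congr_fun h w
  ext s
  by_cases hs : s ∈ T
  · simp [hb s hs]
  · have hs' : b • s ∉ T := fun h => hs (by rwa [← MulAction.injective b (hb _ h)])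
    simp [retract_of_notMem hs, retract_of_notMem hs']

theorem exists_character_of_minimal_support {B S K : Type*} [Group B] [MulAction B S] [Group K]
    (ψ : K →* FreeGroup S ⋊[permAut B S] B) (c : K) (hc : ∀ k, k * c = c * k)
    (w : FreeGroup S) (hw : w ≠ 1) (hψ : ψ c = SemidirectProduct.inl w) (T : Finset S)
    (hT : retract (T : Set S) w = w)
    (hmin : ∀ (U : Finset S) (v : FreeGroup S),
        retract (U : Set S) (v * w * v⁻¹) = v * w * v⁻¹ → T ⊆ U) :
    ∃ f : K →* Multiplicative ℤ, f c ≠ 1 := by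
  classical
  have hcomm : ∀ k, (ψ k).left * permAut B S (ψ k).right w = w * (ψ k).left := by
    intro k
    have h := congrArg SemidirectProduct.left (congrArg ψ (hc k))
    simpa [hψ] using h
  have hinv : ∀ k, ∀ s ∈ T, (ψ k).right • s ∈ T := by
    intro k s hs
    have hsub : T ⊆ T.image ((ψ k⁻¹).right • ·) := by
      refine hmin _ (ψ k⁻¹).left⁻¹ ?_
      have h : (ψ k⁻¹).left⁻¹ * w * (ψ k⁻¹).left⁻¹⁻¹ = permAut B S (ψ k⁻¹).right w := by
        rw [inv_inv, mul_assoc, ← hcomm, inv_mul_cancel_left]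
      have h' := retract_map (T : Set S) (MulAction.toPerm (ψ k⁻¹).right) w
      rw [hT] at h'
      rw [h, Finset.coe_image]
      exact h'
    obtain ⟨t, ht, rfl⟩ := Finset.mem_image.1 (hsub hs)
    simpa using ht
  let _ : MulAction K S := MulAction.compHom S (SemidirectProduct.rightHom.comp ψ)
  have hsmul : ∀ (k : K) (s : S), k • s = (ψ k).right • s := fun _ _ => rfl
  let H : Subgroup K := ⨅ s ∈ T, MulAction.stabilizer K s
  have hHmem : ∀ k : K, k ∈ H ↔ ∀ s ∈ T, (ψ k).right • s = s := by
    intro k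
    simp [H, Subgroup.mem_iInf, MulAction.mem_stabilizer_iff, hsmul]
  have hH : H.FiniteIndex := by
    refine Subgroup.finiteIndex_iInf' _ fun s hs => ⟨?_⟩
    rw [MulAction.index_stabilizer]
    have hfin : (MulAction.orbit K s).Finite := by
      refine T.finite_toSet.subset ?_
      rintro _ ⟨k, rfl⟩
      exact hinv k s hs
    exact ((MulAction.nonempty_orbit s).ncard_pos hfin).ne'
  let r : H →* FreeGroup S :=
    { toFun := fun k => retract (T : Set S) (ψ k).left
      map_one' := by simp
      map_mul' := fun k l => by
        simp only [Subgroup.coe_mul, _root_.map_mul, SemidirectProduct.mul_left]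
        rw [retract_permAut ((hHmem k).1 k.2)] }
  have hcH : c ∈ H := by simp [hHmem, hψ]
  have hr : r ⟨c, hcH⟩ = w := by
    change retract (T : Set S) (ψ c).left = w
    simpa [hψ] using hT
  obtain ⟨f, hf⟩ := (hasCentralCharacters S).exists_character r ⟨c, hcH⟩ (by rwa [hr]) (by
    intro k
    rw [← _root_.map_mul, ← _root_.map_mul]
    congr 1
    exact Subtype.ext (hc k))
  exact exists_character_of_finiteIndex H f c hc 1 (by simpa using hcH) (by simpa using hf)

theorem hasCentralCharacters_semidirectProduct {B S : Type*} [Group B] [MulAction B S]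
    (hB : HasCentralCharacters B) : HasCentralCharacters (FreeGroup S ⋊[permAut B S] B) := by
  intro K z hz hcomm
  by_cases hright : (z : FreeGroup S ⋊[permAut B S] B).right = 1
  · obtain ⟨u, T, hT, hmin⟩ := exists_conj_minimal_support
      (z : FreeGroup S ⋊[permAut B S] B).left
    have hzl : (z : FreeGroup S ⋊[permAut B S] B)
        = SemidirectProduct.inl (z : FreeGroup S ⋊[permAut B S] B).left := by
      ext <;> simp [hright]
    refine exists_character_of_minimal_support
      ((MulAut.conj (SemidirectProduct.inl u)).toMonoidHom.comp K.subtype) z hcomm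
      (u * (z : FreeGroup S ⋊[permAut B S] B).left * u⁻¹) ?_ ?_ T hT fun U v hv => ?_
    · intro h
      apply hz
      rw [conj_eq_one_iff] at h
      ext
      · simp [h]
      · simp [hright]
    · simp only [MonoidHom.comp_apply, Subgroup.subtype_apply, MulEquiv.coe_toMonoidHom,
        MulAut.conj_apply, _root_.map_mul, _root_.map_inv, ← hzl]
    · refine hmin U (v * u) ?_
      simpa only [mul_inv_rev, mul_assoc] using hv
  · refine hB.exists_character (SemidirectProduct.rightHom.comp K.subtype) z hright fun k => ?_
    rw [← _root_.map_mul, ← _root_.map_mul, hcomm]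

end FreeGroup

namespace RAAG

/-- A map from the vertices of `Γ` to a group which sends adjacent vertices to commuting elements
extends to a homomorphism from the right-angled Artin group. -/
def lift {V G : Type*} [Group G] {Γ : SimpleGraph V} (f : V → G)
    (hf : ∀ u w, Γ.Adj u w → f u * f w = f w * f u) : RAAG Γ →* G :=
  PresentedGroup.toGroup (f := f) (by
    rintro _ ⟨u, w, h, rfl⟩
    simp [hf u w h])

@[simp]
theorem lift_of {V G : Type*} [Group G] {Γ : SimpleGraph V} (f : V → G)
    (hf : ∀ u w, Γ.Adj u w → f u * f w = f w * f u) (v : V) :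
    lift f hf (PresentedGroup.of v) = f v :=
  PresentedGroup.toGroup.of _

theorem of_mul_of_comm {V : Type*} {Γ : SimpleGraph V} {u w : V} (h : Γ.Adj u w) :
    (PresentedGroup.of u * PresentedGroup.of w : RAAG Γ)
      = PresentedGroup.of w * PresentedGroup.of u := by
  have h' : PresentedGroup.mk (raagRels Γ) (FreeGroup.of u * FreeGroup.of w *
      (FreeGroup.of u)⁻¹ * (FreeGroup.of w)⁻¹) = 1 :=
    PresentedGroup.one_of_mem ⟨u, w, h, rfl⟩
  simp only [map_mul, map_inv] at h'
  rwa [mul_inv_eq_one, mul_inv_eq_iff_eq_mul] at h'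

section Option

variable {α : Type*} (Γ : SimpleGraph (Option α))

/-- The subgroup generated by the neighbours of the vertex `none`. -/
def link : Subgroup (RAAG (Γ.comap some)) :=
  Subgroup.closure {g | ∃ a, Γ.Adj none (some a) ∧ g = PresentedGroup.of a}

/-- The homomorphism induced by the inclusion of the vertices other than `none`. -/
def inclusion : RAAG (Γ.comap some) →* RAAG Γ :=
  lift (fun a => PresentedGroup.of (some a)) fun _ _ h => of_mul_of_comm h

theorem inclusion_mul_of_none {g : RAAG (Γ.comap some)} (hg : g ∈ link Γ) :
    inclusion Γ g * PresentedGroup.of none = PresentedGroup.of none * inclusion Γ g := by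
  have hle : link Γ ≤ (Subgroup.centralizer {PresentedGroup.of none}).comap (inclusion Γ) := by
    rw [link, Subgroup.closure_le]
    rintro _ ⟨a, ha, rfl⟩
    simp only [Subgroup.coe_comap, Set.mem_preimage, SetLike.mem_coe,
      Subgroup.mem_centralizer_singleton_iff]
    simp [inclusion, of_mul_of_comm ha]
  exact Subgroup.mem_centralizer_singleton_iff.1 (hle hg)

/-- The kernel of the retraction of a right-angled Artin group killing the vertex `none` is free
on the conjugates of `none`; this is the map to the corresponding semidirect product. -/
def toSemidirect : RAAG Γ →* FreeGroup (RAAG (Γ.comap some) ⧸ link Γ)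
    ⋊[FreeGroup.permAut (RAAG (Γ.comap some)) (RAAG (Γ.comap some) ⧸ link Γ)]
      RAAG (Γ.comap some) :=
  have hfix : ∀ a, Γ.Adj none (some a) →
      (PresentedGroup.of a : RAAG (Γ.comap some)) • ((1 : RAAG (Γ.comap some)) :
        RAAG (Γ.comap some) ⧸ link Γ) = ((1 : RAAG (Γ.comap some)) : _ ⧸ link Γ) := by
    intro a ha
    rw [MulAction.Quotient.smul_coe, smul_eq_mul, mul_one, eq_comm, QuotientGroup.eq]
    have hmem : PresentedGroup.of a ∈ link Γ := Subgroup.subset_closure ⟨a, ha, rfl⟩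
    simpa using hmem
  lift (fun v => v.elim
      (SemidirectProduct.inl (FreeGroup.of ((1 : RAAG (Γ.comap some)) : _ ⧸ link Γ)))
      (fun a => SemidirectProduct.inr (PresentedGroup.of a))) (by
    rintro (_ | a) (_ | b) h
    · rfl
    · ext <;> simp [hfix b h]
    · ext <;> simp [hfix a h.symm]
    · simp only [Option.elim_some, ← map_mul]
      rw [of_mul_of_comm (Γ := Γ.comap some) h])

/-- A left inverse of `toSemidirect`. -/
def ofSemidirect : FreeGroup (RAAG (Γ.comap some) ⧸ link Γ)
    ⋊[FreeGroup.permAut (RAAG (Γ.comap some)) (RAAG (Γ.comap some) ⧸ link Γ)]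
      RAAG (Γ.comap some) →* RAAG Γ :=
  SemidirectProduct.lift
    (FreeGroup.lift fun s => Quotient.liftOn' s
      (fun b => inclusion Γ b * PresentedGroup.of none * (inclusion Γ b)⁻¹) (by
        intro b c h
        have h' := inclusion_mul_of_none Γ (QuotientGroup.leftRel_apply.1 (Setoid.symm' _ h))
        rw [map_mul, map_inv] at h'
        rw [mul_inv_eq_iff_eq_mul, mul_assoc, mul_assoc, ← inv_mul_eq_iff_eq_mul,
          ← mul_assoc, h']))
    (inclusion Γ) (by
      intro b
      ext s
      induction s using QuotientGroup.induction_on with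
      | H c => simp [mul_assoc])

theorem toSemidirect_injective : Function.Injective (toSemidirect Γ) := by
  suffices h : (ofSemidirect Γ).comp (toSemidirect Γ) = MonoidHom.id _ from
    Function.LeftInverse.injective (g := ofSemidirect Γ) (DFunLike.congr_fun h)
  refine PresentedGroup.ext ?_
  rintro (_ | a)
  · simp [toSemidirect, ofSemidirect]
  · simp [toSemidirect, ofSemidirect, inclusion]

end Option

theorem hasCentralCharacters {V : Type} [Finite V] (Γ : SimpleGraph V) :
    HasCentralCharacters (RAAG Γ) := by
  revert Γ
  refine Finite.induction_empty_option (P := fun V => ∀ Γ : SimpleGraph V,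
    HasCentralCharacters (RAAG Γ)) ?_ ?_ ?_ V
  · intro α β e h Γ
    have hinj : Function.LeftInverse
        (lift (Γ := Γ.comap e) (fun a => (PresentedGroup.of (e a) : RAAG Γ))
          fun _ _ h => of_mul_of_comm h)
        (lift (Γ := Γ) (fun b => (PresentedGroup.of (e.symm b) : RAAG (Γ.comap e)))
          fun u w h => of_mul_of_comm (by simpa using h)) := by
      intro x
      rw [← MonoidHom.comp_apply]
      refine DFunLike.congr_fun (g := MonoidHom.id _) (PresentedGroup.ext fun b => ?_) x
      simp
    exact (h (Γ.comap e)).of_injective _ hinj.injective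
  · intro Γ K z hz
    refine absurd (Subtype.ext ?_) hz
    refine DFunLike.congr_fun (f := MonoidHom.id (RAAG Γ)) (g := 1)
      (PresentedGroup.ext fun b => b.elim) (z : RAAG Γ)
  · intro α _ h Γ
    exact (FreeGroup.hasCentralCharacters_semidirectProduct (h (Γ.comap some))).of_injective _
      (toSemidirect_injective Γ)

end RAAG

/-- In a group commensurable with a right-angled Artin group, a central element of infinite order
is detected by an integer-valued character. -/
theorem AbstractlyCommensurable.exists_character {V : Type} [Finite V] {Γ : SimpleGraph V}
    {G K : Type*} [Group G] [Group K] (h : AbstractlyCommensurable G (RAAG Γ)) (ψ : K →* G)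
    (c : K) (hc : ∀ k, k * c = c * k) (hinf : ∀ m : ℕ, m ≠ 0 → ψ c ^ m ≠ 1) :
    ∃ f : K →* Multiplicative ℤ, f c ≠ 1 := by
  obtain ⟨G', H', hG', -, ⟨e⟩⟩ := h
  have hfin : (G'.comap ψ).FiniteIndex := ⟨by
    rw [Subgroup.index_comap]
    exact (Subgroup.isFiniteRelIndex_of_finiteIndex (H := G') (K := ψ.range)).relIndex_ne_zero⟩
  obtain ⟨m, hm0, -, hm⟩ := Subgroup.exists_pow_mem_of_index_ne_zero hfin.index_ne_zero c
  obtain ⟨f, hf⟩ := (RAAG.hasCentralCharacters Γ).exists_character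
    (H'.subtype.comp (e.toMonoidHom.comp (ψ.subgroupComap G'))) ⟨c ^ m, hm⟩ (by
      intro h1
      have h2 : e (ψ.subgroupComap G' ⟨c ^ m, hm⟩) = 1 := Subtype.ext h1
      rw [map_eq_one_iff e e.injective] at h2
      refine hinf m hm0.ne' ?_
      rw [← map_pow]
      exact congrArg Subtype.val h2) (by
      intro k
      rw [← map_mul, ← map_mul]
      congr 1
      exact Subtype.ext ((show Commute (k : K) c from hc k).pow_right m))
  exact exists_character_of_finiteIndex _ f c hc m hm hf

namespace FreeGroup

section Automorphisms

variable {X : Type*} [DecidableEq X]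

/-- The transvection `x ↦ x * y`. -/
def transvection (x y : X) (h : y ≠ x) : MulAut (FreeGroup X) :=
  MonoidHom.toMulEquiv
    (lift fun i => if i = x then of x * of y else of i)
    (lift fun i => if i = x then of x * (of y)⁻¹ else of i)
    (by ext i; by_cases hi : i = x <;> simp [hi, h])
    (by ext i; by_cases hi : i = x <;> simp [hi, h])

@[simp]
theorem transvection_of {x y : X} (h : y ≠ x) (i : X) :
    transvection x y h (of i) = if i = x then of x * of y else of i := by
  simp [transvection]

/-- The automorphism inverting the generator `x`. -/
def inversion (x : X) : MulAut (FreeGroup X) :=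
  MonoidHom.toMulEquiv
    (lift fun i => if i = x then (of x)⁻¹ else of i)
    (lift fun i => if i = x then (of x)⁻¹ else of i)
    (by ext i; by_cases hi : i = x <;> simp [hi])
    (by ext i; by_cases hi : i = x <;> simp [hi])

@[simp]
theorem inversion_of (x i : X) :
    inversion x (of i) = if i = x then (of x)⁻¹ else of i := by
  simp [inversion]

/-- The partial conjugation of the generators `b` and `c` by the generator `a`. -/
def partialConj (a b c : X) (hb : a ≠ b) (hc : a ≠ c) : MulAut (FreeGroup X) :=
  MonoidHom.toMulEquiv
    (lift fun i => if i = b ∨ i = c then of a * of i * (of a)⁻¹ else of i)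
    (lift fun i => if i = b ∨ i = c then (of a)⁻¹ * of i * of a else of i)
    (by ext i; by_cases hi : i = b ∨ i = c <;> simp [hi, hb, hc, mul_assoc])
    (by ext i; by_cases hi : i = b ∨ i = c <;> simp [hi, hb, hc, mul_assoc])

@[simp]
theorem partialConj_of {a b c : X} (hb : a ≠ b) (hc : a ≠ c) (i : X) :
    partialConj a b c hb hc (of i)
      = if i = b ∨ i = c then of a * of i * (of a)⁻¹ else of i := by
  simp [partialConj]

theorem mulAut_ext {Y : Type*} {f g : MulAut (FreeGroup Y)} (h : ∀ i, f (of i) = g (of i)) :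
    f = g := by
  apply MulEquiv.toMonoidHom_injective
  ext i
  exact h i

variable {a b c : X} (hab : a ≠ b) (hac : a ≠ c)

theorem character_partialConj_eq_one (hbc : b ≠ c)
    (f : Subgroup.centralizer {partialConj a b c hab hac} →* Multiplicative ℤ) :
    f ⟨partialConj a b c hab hac, by simp [Subgroup.mem_centralizer_singleton_iff]⟩ = 1 := by
  have mem : ∀ g : MulAut (FreeGroup X), (∀ i, g (partialConj a b c hab hac (of i))
      = partialConj a b c hab hac (g (of i))) →
      g ∈ Subgroup.centralizer {partialConj a b c hab hac} := by
    intro g h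
    rw [Subgroup.mem_centralizer_singleton_iff]
    exact mulAut_ext h
  have hca := hac.symm
  have hba := hab.symm
  have hcb := hbc.symm
  let Tba : Subgroup.centralizer {partialConj a b c hab hac} :=
    ⟨transvection b a hab, mem _ fun i => by
      by_cases h1 : i = b <;> by_cases h2 : i = c <;> simp_all [mul_assoc]⟩
  let Tca : Subgroup.centralizer {partialConj a b c hab hac} :=
    ⟨transvection c a hac, mem _ fun i => by
      by_cases h1 : i = b <;> by_cases h2 : i = c <;> simp_all [mul_assoc]⟩
  let Tbc : Subgroup.centralizer {partialConj a b c hab hac} :=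
    ⟨transvection b c hcb, mem _ fun i => by
      by_cases h1 : i = b <;> by_cases h2 : i = c <;> simp_all [mul_assoc]⟩
  let Tcb : Subgroup.centralizer {partialConj a b c hab hac} :=
    ⟨transvection c b hbc, mem _ fun i => by
      by_cases h1 : i = b <;> by_cases h2 : i = c <;> simp_all [mul_assoc]⟩
  let Ib : Subgroup.centralizer {partialConj a b c hab hac} :=
    ⟨inversion b, mem _ fun i => by
      by_cases h1 : i = b <;> by_cases h2 : i = c <;> simp_all [mul_assoc]⟩
  let Ic : Subgroup.centralizer {partialConj a b c hab hac} :=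
    ⟨inversion c, mem _ fun i => by
      by_cases h1 : i = b <;> by_cases h2 : i = c <;> simp_all [mul_assoc]⟩
  have hTba : f Tba = 1 := by
    have h : Tca * Tbc = Tbc * Tba * Tca := Subtype.ext <| mulAut_ext fun i => by
      by_cases h1 : i = b <;> by_cases h2 : i = c <;> simp_all [Tca, Tbc, Tba, mul_assoc]
    have h' := congrArg f h
    rw [_root_.map_mul, _root_.map_mul, _root_.map_mul, mul_comm (f Tca)] at h'
    simpa using h'
  have hTca : f Tca = 1 := by
    have h : Tba * Tcb = Tcb * Tca * Tba := Subtype.ext <| mulAut_ext fun i => by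
      by_cases h1 : i = b <;> by_cases h2 : i = c <;> simp_all [Tca, Tcb, Tba, mul_assoc]
    have h' := congrArg f h
    rw [_root_.map_mul, _root_.map_mul, _root_.map_mul, mul_comm (f Tba)] at h'
    simpa using h'
  have hIb : Ib * Ib = 1 := Subtype.ext <| mulAut_ext fun i => by
    by_cases h1 : i = b <;> simp_all [Ib]
  have hIc : Ic * Ic = 1 := Subtype.ext <| mulAut_ext fun i => by
    by_cases h1 : i = c <;> simp_all [Ic]
  have hz : (⟨partialConj a b c hab hac, by simp [Subgroup.mem_centralizer_singleton_iff]⟩ :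
      Subgroup.centralizer {partialConj a b c hab hac}) *
      (Tca * (Ic * Tca * Ic) * (Tba * (Ib * Tba * Ib))) = 1 :=
    Subtype.ext <| mulAut_ext fun i => by
      by_cases h1 : i = b <;> by_cases h2 : i = c <;>
        simp_all [Tca, Tba, Ib, Ic, mul_assoc]
  have hz' := congrArg f hz
  have hIb' : f Ib * f Ib = 1 := by rw [← _root_.map_mul, hIb, _root_.map_one]
  have hIc' : f Ic * f Ic = 1 := by rw [← _root_.map_mul, hIc, _root_.map_one]
  simpa [hTba, hTca, hIb', hIc'] using hz'

theorem partialConj_pow_apply (m : ℕ) (i : X) :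
    (partialConj a b c hab hac ^ m) (of i)
      = if i = b ∨ i = c then of a ^ m * of i * (of a ^ m)⁻¹ else of i := by
  induction m with
  | zero => simp
  | succ m ih =>
    rw [pow_succ', MulAut.mul_apply, ih]
    split_ifs with hi
    · have ha : partialConj a b c hab hac (of a) = of a := by simp [hab, hac]
      rw [_root_.map_mul, _root_.map_mul, _root_.map_inv, _root_.map_pow, ha, partialConj_of, if_pos hi, pow_succ]
      group
    · rw [partialConj_of, if_neg hi]

theorem partialConj_pow_notMem_inner {d : X} (hda : d ≠ a) (hdb : d ≠ b) (hdc : d ≠ c) {m : ℕ}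
    (hm : m ≠ 0) :
    partialConj a b c hab hac ^ m ∉ innerAutSubgroup (FreeGroup X) := by
  rintro ⟨w, hw⟩
  have hb := partialConj_pow_apply hab hac m b
  have hd := partialConj_pow_apply hab hac m d
  rw [← hw, MulAut.conj_apply] at hb hd
  rw [if_pos (Or.inl rfl)] at hb
  rw [if_neg (by simp [hdb, hdc])] at hd
  let θ : FreeGroup X →* Matrix.SpecialLinearGroup (Fin 2) ℤ :=
    lift fun i => if i = a then ModularGroup.T else ModularGroup.S
  have hb' := congrArg θ hb
  have hd' := congrArg θ hd
  simp only [_root_.map_mul, _root_.map_inv, _root_.map_pow, θ, lift_apply_of, if_pos, if_neg hab.symm,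
    if_neg hda] at hb' hd'
  rw [hd', eq_mul_inv_iff_mul_eq] at hb'
  have hmat := congrArg Subtype.val hb'
  rw [← zpow_natCast, Matrix.SpecialLinearGroup.coe_mul, Matrix.SpecialLinearGroup.coe_mul,
    ModularGroup.coe_T_zpow, ModularGroup.coe_S] at hmat
  have h00 := congrFun (congrFun hmat 0) 0
  simp at h00
  exact hm (by exact_mod_cast h00.symm)

end Automorphisms

end FreeGroup

/-- For `n ≥ 4`, the outer automorphism group of the free group on `n` generators is
not abstractly commensurable with any right-angled Artin group. -/
theorem out_free_not_commensurable_raag (n : ℕ) (hn : 4 ≤ n) :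
    ∀ {V : Type} [Fintype V] (Γ : SimpleGraph V),
      ¬ AbstractlyCommensurable (Out (FreeGroup (Fin n))) (RAAG Γ) := by
  intro V _ Γ h
  obtain ⟨a, b, c, d, hab, hac, hbc, hda, hdb, hdc⟩ : ∃ a b c d : Fin n,
      a ≠ b ∧ a ≠ c ∧ b ≠ c ∧ d ≠ a ∧ d ≠ b ∧ d ≠ c :=
    ⟨⟨0, by omega⟩, ⟨1, by omega⟩, ⟨2, by omega⟩, ⟨3, by omega⟩, by simp⟩
  let z := FreeGroup.partialConj a b c hab hac
  let π : MulAut (FreeGroup (Fin n)) →* Out (FreeGroup (Fin n)) :=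
    QuotientGroup.mk' (innerAutSubgroup (FreeGroup (Fin n)))
  have hz : z ∈ Subgroup.centralizer {z} := by simp [Subgroup.mem_centralizer_singleton_iff]
  obtain ⟨f, hf⟩ := h.exists_character (π.comp (Subgroup.centralizer {z}).subtype) ⟨z, hz⟩
    (fun k => Subtype.ext (Subgroup.mem_centralizer_singleton_iff.1 k.2)) (fun m hm h1 => by
      rw [← map_pow] at h1
      exact FreeGroup.partialConj_pow_notMem_inner hab hac hda hdb hdc hm
        ((QuotientGroup.eq_one_iff _).1 h1))
  exact hf (FreeGroup.character_partialConj_eq_one hab hac hbc f)
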